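/- arXiv:1204.2253 — 2 statements merged into one kernel-verified Lean document; each statement's English description precedes it below -/
import Mathlib

section
/- Let k > 2 be an integer. Define f_∞ : GL₂(ℝ) → ℂ by f_∞([[a,b],[c,d]]) = ((k−1)/(4π)) · (ad−bc)^{k/2} (2i)^k / (−b + c + (a+d)i)^k when ad − bc > 0, and f_∞(g) = 0 when det(g) < 0. Then f_∞ is idempotent under convolution over GL₂(ℝ) modulo its center: for every g₀ ∈ GL₂(ℝ), ∫₀^{2π} ∫_{ℝ} ∫_{ℝ∖{0}} f_∞(h_{y,x,θ}) · f_∞(h_{y,x,θ}^{−1} g₀) (dy/|y|) dx (dθ/(2π)) = f_∞(g₀), where h_{y,x,θ} = [[y, yx],[0,1]] · [[cos θ, −sin θ],[sin θ, cos θ]]. -/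
open Complex

noncomputable section

/-- The matrix coefficient `f_∞` of the weight-`k` discrete series of `GL₂(ℝ)`, scaled by
the formal degree: `f_∞([[a,b],[c,d]]) = ((k-1)/4π)·det^{k/2}(2i)^k/(-b+c+(a+d)i)^k` when
the determinant is positive, and `0` otherwise. -/
def finf (k : ℕ) (g : Matrix (Fin 2) (Fin 2) ℝ) : ℂ :=
  if 0 < g.det then
    ((((k : ℝ) - 1) / (4 * Real.pi) : ℝ) : ℂ) * ((g.det ^ ((k : ℝ) / 2) : ℝ) : ℂ) *
        (2 * I) ^ k /
      (-(g 0 1 : ℂ) + (g 1 0 : ℂ) + ((g 0 0 : ℂ) + (g 1 1 : ℂ)) * I) ^ k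
  else 0

/-- The Iwasawa parametrization `h_{y,x,θ} = [[y, yx],[0,1]]·k_θ` of `GL₂(ℝ)` modulo its
center. -/
def iwasawaMat (y x θ : ℝ) : Matrix (Fin 2) (Fin 2) ℝ :=
  !![y, y * x; 0, 1] * !![Real.cos θ, -Real.sin θ; Real.sin θ, Real.cos θ]

theorem add_mul_ne_zero_of_norm_lt {a b w : ℂ} (hab : ‖b‖ < ‖a‖) (hw : ‖w‖ ≤ 1) :
    a + b * w ≠ 0 := by
  intro h
  have h1 : ‖a‖ = ‖b‖ * ‖w‖ := by
    rw [← norm_mul, ← norm_neg (b * w), ← eq_neg_of_add_eq_zero_left h]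
  nlinarith [norm_nonneg b, norm_nonneg w]

theorem continuousOn_add_mul_pow_inv {a b : ℂ} (hab : ‖b‖ < ‖a‖) (k : ℕ) :
    ContinuousOn (fun w : ℂ => ((a + b * w) ^ k)⁻¹) (Metric.closedBall 0 1) := by
  refine ContinuousOn.inv₀ (by fun_prop) fun w hw => pow_ne_zero _ ?_
  exact add_mul_ne_zero_of_norm_lt hab (by simpa using hw)

theorem integral_angle_add_mul_pow_inv {a b : ℂ} (hab : ‖b‖ < ‖a‖) (k : ℕ) {r : ℝ}
    (hr0 : 0 ≤ r) (hr1 : r ≤ 1) :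
    ∫ θ in Set.Ioo (-Real.pi) Real.pi,
      ((a + b * (r * (Real.cos θ + Real.sin θ * I))) ^ k)⁻¹ = 2 * Real.pi * (a ^ k)⁻¹ := by
  have hd : DiffContOnCl ℂ (fun w : ℂ => ((a + b * w) ^ k)⁻¹) (Metric.ball 0 |r|) := by
    apply DifferentiableOn.diffContOnCl
    intro w hw
    have hw' : ‖w‖ ≤ 1 := by
      have := Metric.closure_ball_subset_closedBall hw
      rw [abs_of_nonneg hr0] at this
      simp at this
      linarith
    refine DifferentiableAt.differentiableWithinAt ?_
    exact DifferentiableAt.inv (by fun_prop)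
      (pow_ne_zero _ (add_mul_ne_zero_of_norm_lt hab hw'))
  have h := hd.circleAverage
  rw [Real.circleAverage_eq_integral_add (-Real.pi)] at h
  rw [← MeasureTheory.integral_Ioc_eq_integral_Ioo,
    ← intervalIntegral.integral_of_le (by linarith [Real.pi_pos])]
  rw [intervalIntegral.integral_comp_add_right
    (f := fun θ => ((a + b * circleMap 0 r θ) ^ k)⁻¹)] at h
  simp only [zero_add] at h
  rw [show 2 * Real.pi + -Real.pi = Real.pi by ring] at h
  simp only [circleMap, zero_add, exp_mul_I, ← ofReal_cos, ← ofReal_sin, mul_zero, add_zero] at h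
  rw [inv_smul_eq_iff₀ (by positivity)] at h
  simpa using h

theorem integral_mul_one_sub_sq_pow (n : ℕ) :
    ∫ r in Set.Ioo (0 : ℝ) 1, r * (1 - r ^ 2) ^ n = 1 / (2 * ((n : ℝ) + 1)) := by
  rw [← MeasureTheory.integral_Ioc_eq_integral_Ioo,
    ← intervalIntegral.integral_of_le zero_le_one]
  rw [intervalIntegral.integral_eq_sub_of_hasDerivAt
    (f := fun r : ℝ => -(1 - r ^ 2) ^ (n + 1) / (2 * (n + 1)))]
  · simp
    field_simp
  · intro r _
    have h : HasDerivAt (fun r : ℝ => -(1 - r ^ 2) ^ (n + 1) / (2 * (n + 1)))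
      (-(((n + 1 : ℕ) : ℝ) * (1 - r ^ 2) ^ n * (-((2 : ℕ) * r ^ 1))) / (2 * (n + 1))) r :=
      ((((hasDerivAt_pow 2 r).const_sub 1).pow (n + 1)).neg).div_const _
    refine h.congr_deriv ?_
    push_cast
    field_simp
  · exact (by fun_prop : Continuous _).intervalIntegrable _ _

open MeasureTheory in
theorem integral_ball_weight_mul_pow_inv {a b : ℂ} (hab : ‖b‖ < ‖a‖) (n k : ℕ) :
    ∫ w in Metric.ball (0 : ℂ) 1, (((1 - ‖w‖ ^ 2) ^ n : ℝ) : ℂ) * ((a + b * w) ^ k)⁻¹ =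
      Real.pi / (n + 1) * (a ^ k)⁻¹ := by
  rw [← integral_indicator measurableSet_ball, ← Complex.integral_comp_polarCoord_symm]
  have hset : polarCoord.target ∩ (Set.Iio (1 : ℝ) ×ˢ Set.univ) =
      Set.Ioo (0 : ℝ) 1 ×ˢ Set.Ioo (-Real.pi) Real.pi := by
    rw [polarCoord_target, Set.prod_inter_prod, Set.Ioi_inter_Iio, Set.inter_univ]
  have hpt : ∀ p ∈ polarCoord.target, p.1 • (Metric.ball (0 : ℂ) 1).indicator
      (fun w => (((1 - ‖w‖ ^ 2) ^ n : ℝ) : ℂ) * ((a + b * w) ^ k)⁻¹) (Complex.polarCoord.symm p) =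
      (Set.Iio (1 : ℝ) ×ˢ (Set.univ : Set ℝ)).indicator
        (fun p : ℝ × ℝ => ((p.1 * (1 - p.1 ^ 2) ^ n : ℝ) : ℂ) *
          ((a + b * (p.1 * (Real.cos p.2 + Real.sin p.2 * I))) ^ k)⁻¹) p := by
    rintro ⟨r, θ⟩ hp
    have hr : 0 < r := hp.1
    have hn : ‖Complex.polarCoord.symm (r, θ)‖ = r := by
      rw [Complex.norm_polarCoord_symm, abs_of_pos hr]
    by_cases h1 : r < 1
    · rw [Set.indicator_of_mem (by simpa [hn, abs_of_pos hr] using h1), Set.indicator_of_mem (by simpa using h1),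
        hn, Complex.polarCoord_symm_apply]
      simp only [real_smul]
      push_cast
      ring
    · rw [Set.indicator_of_notMem (by simpa [hn, abs_of_pos hr] using h1),
        Set.indicator_of_notMem (by simpa using h1), smul_zero]
  rw [setIntegral_congr_fun polarCoord.open_target.measurableSet hpt,
    setIntegral_indicator (measurableSet_Iio.prod MeasurableSet.univ), hset]
  rw [Measure.volume_eq_prod, setIntegral_prod]
  · have : ∀ r ∈ Set.Ioo (0 : ℝ) 1, ∫ θ in Set.Ioo (-Real.pi) Real.pi,
        ((r * (1 - r ^ 2) ^ n : ℝ) : ℂ) *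
          ((a + b * (r * (Real.cos θ + Real.sin θ * I))) ^ k)⁻¹ =
        ((r * (1 - r ^ 2) ^ n : ℝ) : ℂ) * (2 * Real.pi * (a ^ k)⁻¹) := by
      intro r hr
      rw [integral_const_mul, integral_angle_add_mul_pow_inv hab k hr.1.le hr.2.le]
    rw [setIntegral_congr_fun measurableSet_Ioo this, integral_mul_const, integral_complex_ofReal,
      integral_mul_one_sub_sq_pow]
    push_cast
    field_simp
  · refine IntegrableOn.mono_set (t := Set.Icc (0 : ℝ) 1 ×ˢ Set.Icc (-Real.pi) Real.pi) ?_
      (Set.prod_mono Set.Ioo_subset_Icc_self Set.Ioo_subset_Icc_self)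
    refine ContinuousOn.integrableOn_compact (isCompact_Icc.prod isCompact_Icc) ?_
    refine ContinuousOn.mul (by fun_prop) ?_
    refine (continuousOn_add_mul_pow_inv hab k).comp
      (f := fun p : ℝ × ℝ => (p.1 : ℂ) * (Real.cos p.2 + Real.sin p.2 * I)) (by fun_prop) ?_
    rintro ⟨r, θ⟩ ⟨hr, -⟩
    have hr' : 0 ≤ r ∧ r ≤ 1 := hr
    have : ‖(Real.cos θ : ℂ) + Real.sin θ * I‖ = 1 := by
      simp
    simp only [Metric.mem_closedBall, dist_zero_right, norm_mul, this, norm_real, mul_one,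
      Real.norm_eq_abs, abs_of_nonneg hr'.1, hr'.2]

open MeasureTheory in
theorem integrableOn_ball_weight_mul_pow_inv {a b : ℂ} (hab : ‖b‖ < ‖a‖) (n k : ℕ) :
    IntegrableOn (fun w : ℂ => (((1 - ‖w‖ ^ 2) ^ n : ℝ) : ℂ) * ((a + b * w) ^ k)⁻¹)
      (Metric.ball (0 : ℂ) 1) := by
  refine IntegrableOn.mono_set (t := Metric.closedBall 0 1) ?_ Metric.ball_subset_closedBall
  refine ContinuousOn.integrableOn_compact (isCompact_closedBall 0 1) ?_
  exact ContinuousOn.mul (by fun_prop) (continuousOn_add_mul_pow_inv hab k)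

/-- The Cayley transform from the unit disc to the upper half plane. -/
def cayleyMap (w : ℂ) : ℂ := I * (1 + w) / (1 - w)

theorem one_sub_ne_zero_of_mem_ball {w : ℂ} (hw : w ∈ Metric.ball (0 : ℂ) 1) : 1 - w ≠ 0 := by
  intro h
  rw [← sub_eq_zero.mp h] at hw
  simp at hw

theorem hasDerivAt_cayleyMap {w : ℂ} (hw : 1 - w ≠ 0) :
    HasDerivAt cayleyMap (2 * I / (1 - w) ^ 2) w := by
  have h := (((hasDerivAt_id w).const_add 1).const_mul I).div ((hasDerivAt_id w).const_sub 1) hw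
  refine h.congr_deriv ?_
  simp only [id]
  congr 1
  ring

theorem cayleyMap_im (w : ℂ) : (cayleyMap w).im = (1 - ‖w‖ ^ 2) / ‖1 - w‖ ^ 2 := by
  rw [cayleyMap, div_im, ← normSq_eq_norm_sq, ← normSq_eq_norm_sq]
  simp [normSq_apply]
  ring

theorem injOn_cayleyMap : Set.InjOn cayleyMap (Metric.ball 0 1) := by
  intro w hw z hz h
  have hw' := one_sub_ne_zero_of_mem_ball hw
  have hz' := one_sub_ne_zero_of_mem_ball hz
  rw [cayleyMap, cayleyMap, div_eq_div_iff hw' hz', mul_assoc, mul_assoc,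
    mul_right_inj' I_ne_zero] at h
  linear_combination h / 2

theorem image_cayleyMap_ball : cayleyMap '' Metric.ball 0 1 = {τ : ℂ | 0 < τ.im} := by
  ext τ
  constructor
  · rintro ⟨w, hw, rfl⟩
    have hw' := one_sub_ne_zero_of_mem_ball hw
    have h1 : ‖w‖ < 1 := by simpa using hw
    change 0 < (cayleyMap w).im
    rw [cayleyMap_im]
    have : 0 < ‖1 - w‖ := norm_pos_iff.mpr hw'
    have : 0 < 1 - ‖w‖ ^ 2 := by nlinarith [norm_nonneg w]
    positivity
  · intro hτ
    have hτ : 0 < τ.im := hτ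
    have h0 : τ + I ≠ 0 := by
      intro h
      have := congrArg Complex.im h
      simp at this
      linarith
    refine ⟨(τ - I) / (τ + I), ?_, ?_⟩
    · rw [mem_ball_zero_iff, norm_div, div_lt_one (norm_pos_iff.mpr h0)]
      refine lt_of_pow_lt_pow_left₀ 2 (norm_nonneg _) ?_
      rw [← normSq_eq_norm_sq, ← normSq_eq_norm_sq]
      simp only [normSq_apply, sub_re, add_re, sub_im, add_im, I_re, I_im]
      nlinarith
    · have h1 : 1 - (τ - I) / (τ + I) = 2 * I / (τ + I) := by
        field_simp
        ring
      rw [cayleyMap, h1]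
      field_simp
      ring

/-- The real derivative of the Cayley transform. -/
def cayleyFDeriv (w : ℂ) : ℂ →L[ℝ] ℂ :=
  (ContinuousLinearMap.toSpanSingleton ℂ (2 * I / (1 - w) ^ 2)).restrictScalars ℝ

theorem abs_det_cayleyFDeriv (w : ℂ) : |(cayleyFDeriv w).det| = 4 / ‖1 - w‖ ^ 4 := by
  have : (cayleyFDeriv w).det = 4 / ‖1 - w‖ ^ 4 := by
    simp [cayleyFDeriv, ContinuousLinearMap.det, LinearMap.det_restrictScalars,
      Algebra.norm_complex_eq, Complex.normSq_eq_norm_sq, ← pow_mul]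
    norm_num
  rw [this, abs_of_nonneg (by positivity)]

theorem abs_det_smul_cayleyMap (α β : ℂ) (n : ℕ) {w : ℂ} (hw : w ∈ Metric.ball (0 : ℂ) 1) :
    |(cayleyFDeriv w).det| • ((((cayleyMap w).im ^ n : ℝ) : ℂ) *
      ((α * cayleyMap w + β) ^ (n + 2))⁻¹ *
        ((I - (starRingEnd ℂ) (cayleyMap w)) ^ (n + 2))⁻¹) =
      4 * ((2 * I) ^ (n + 2))⁻¹ * ((((1 - ‖w‖ ^ 2) ^ n : ℝ) : ℂ) *
        (((I * α + β) + (I * α - β) * w) ^ (n + 2))⁻¹) := by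
  have h1 := one_sub_ne_zero_of_mem_ball hw
  have h2 : 1 - (starRingEnd ℂ) w ≠ 0 := by
    have := (map_ne_zero (starRingEnd ℂ)).mpr h1
    simpa using this
  have h3 : α * cayleyMap w + β = ((I * α + β) + (I * α - β) * w) / (1 - w) := by
    rw [cayleyMap]
    field_simp
    ring
  have h4 : I - (starRingEnd ℂ) (cayleyMap w) = 2 * I / (1 - (starRingEnd ℂ) w) := by
    simp only [cayleyMap, map_div₀, map_mul, conj_I, map_add, map_one, map_sub]
    field_simp
    ring
  have h5 : ((‖1 - w‖ : ℝ) : ℂ) ^ 2 = (1 - w) * (1 - (starRingEnd ℂ) w) := by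
    rw [← Complex.mul_conj']
    simp
  rw [abs_det_cayleyFDeriv, h3, h4, cayleyMap_im, real_smul]
  push_cast
  rw [show ((‖1 - w‖ : ℝ) : ℂ) ^ 4 = (((‖1 - w‖ : ℝ) : ℂ) ^ 2) ^ 2 by ring, h5]
  simp only [mul_pow, pow_add, div_eq_mul_inv, mul_inv]
  field_simp

open MeasureTheory in
/-- The reproducing property at `I` of the weighted Bergman kernel of the upper half plane, for
the function `τ ↦ (α * τ + β) ^ (-(n + 2))`. -/
theorem integral_upperHalfPlane_reproducing {α β : ℂ} (h : ‖I * α - β‖ < ‖I * α + β‖) (n : ℕ) :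
    ∫ τ in {τ : ℂ | 0 < τ.im}, (((τ.im ^ n : ℝ) : ℂ) * ((α * τ + β) ^ (n + 2))⁻¹ *
        ((I - (starRingEnd ℂ) τ) ^ (n + 2))⁻¹) =
      4 * ((2 * I) ^ (n + 2))⁻¹ * (Real.pi / (n + 1) * ((I * α + β) ^ (n + 2))⁻¹) := by
  rw [← image_cayleyMap_ball, integral_image_eq_integral_abs_det_fderiv_smul volume
    measurableSet_ball (f' := cayleyFDeriv)
    (fun w hw => (((hasDerivAt_cayleyMap (one_sub_ne_zero_of_mem_ball hw)).hasFDerivAt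
      ).restrictScalars ℝ).hasFDerivWithinAt) injOn_cayleyMap,
    setIntegral_congr_fun measurableSet_ball (fun w hw => abs_det_smul_cayleyMap α β n hw),
    integral_const_mul, integral_ball_weight_mul_pow_inv h]

open MeasureTheory in
theorem integrableOn_upperHalfPlane_reproducing {α β : ℂ} (h : ‖I * α - β‖ < ‖I * α + β‖)
    (n : ℕ) :
    IntegrableOn (fun τ : ℂ => (((τ.im ^ n : ℝ) : ℂ) * ((α * τ + β) ^ (n + 2))⁻¹ *
        ((I - (starRingEnd ℂ) τ) ^ (n + 2))⁻¹)) {τ : ℂ | 0 < τ.im} := by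
  rw [← image_cayleyMap_ball, integrableOn_image_iff_integrableOn_abs_det_fderiv_smul volume
    measurableSet_ball (f' := cayleyFDeriv)
    (fun w hw => (((hasDerivAt_cayleyMap (one_sub_ne_zero_of_mem_ball hw)).hasFDerivAt
      ).restrictScalars ℝ).hasFDerivWithinAt) injOn_cayleyMap,
    integrableOn_congr_fun (fun w hw => abs_det_smul_cayleyMap α β n hw) measurableSet_ball]
  exact (integrableOn_ball_weight_mul_pow_inv h n (n + 2)).const_mul _

/-- The shear `(x, y) ↦ (y * x, y)`. -/
def shearMap (p : ℝ × ℝ) : ℝ × ℝ := (p.2 * p.1, p.2)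

/-- The derivative of the shear. -/
def shearFDeriv (p : ℝ × ℝ) : ℝ × ℝ →L[ℝ] ℝ × ℝ :=
  (Matrix.toLin (.finTwoProd ℝ) (.finTwoProd ℝ) !![p.2, p.1; 0, 1]).toContinuousLinearMap

theorem hasFDerivAt_shearMap (p : ℝ × ℝ) : HasFDerivAt shearMap (shearFDeriv p) p := by
  unfold shearFDeriv
  rw [Matrix.toLin_finTwoProd_toContinuousLinearMap]
  refine (HasFDerivAt.prodMk (𝕜 := ℝ) ((hasFDerivAt_snd (p := p)).mul hasFDerivAt_fst)
    (hasFDerivAt_snd (p := p))).congr_fderiv ?_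
  simp

theorem det_shearFDeriv (p : ℝ × ℝ) : (shearFDeriv p).det = p.2 := by
  unfold shearFDeriv
  simp only [LinearMap.det_toContinuousLinearMap, LinearMap.det_toLin, Matrix.det_fin_two_of]
  ring

theorem injOn_shearMap : Set.InjOn shearMap (Set.univ ×ˢ Set.Ioi 0) := by
  rintro ⟨x, y⟩ ⟨-, hy⟩ ⟨x', y'⟩ ⟨-, hy'⟩ h
  have hy : 0 < y := hy
  simp only [shearMap, Prod.mk.injEq] at h
  obtain ⟨h1, rfl⟩ := h
  rw [mul_left_cancel₀ hy.ne' h1]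

theorem image_shearMap :
    shearMap '' (Set.univ ×ˢ Set.Ioi 0) = (Set.univ : Set ℝ) ×ˢ Set.Ioi (0 : ℝ) := by
  ext ⟨x, y⟩
  constructor
  · rintro ⟨⟨x', y'⟩, ⟨-, hy⟩, h⟩
    simp only [shearMap, Prod.mk.injEq] at h
    exact ⟨trivial, h.2 ▸ hy⟩
  · rintro ⟨-, hy⟩
    have hy : 0 < y := hy
    exact ⟨(x / y, y), ⟨trivial, hy⟩, by simp [shearMap, mul_div_cancel₀ _ hy.ne']⟩

open MeasureTheory in
theorem integral_integral_shear {g : ℂ → ℂ} (hg : IntegrableOn g {τ : ℂ | 0 < τ.im}) :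
    ∫ x : ℝ, ∫ y in Set.Ioi (0 : ℝ), (y : ℂ) * g (⟨y * x, y⟩) = ∫ τ in {τ : ℂ | 0 < τ.im}, g τ := by
  have hpre : measurableEquivRealProd.symm ⁻¹' {τ : ℂ | 0 < τ.im} =
      (Set.univ : Set ℝ) ×ˢ Set.Ioi (0 : ℝ) := by
    ext ⟨x, y⟩
    simp [measurableEquivRealProd]
  have hmp := volume_preserving_equiv_real_prod.symm
  have hg' : IntegrableOn (fun p => g (measurableEquivRealProd.symm p))
      ((Set.univ : Set ℝ) ×ˢ Set.Ioi (0 : ℝ)) := by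
    rw [← hpre]
    exact (hmp.integrableOn_comp_preimage measurableEquivRealProd.symm.measurableEmbedding).mpr hg
  have hms : MeasurableSet ((Set.univ : Set ℝ) ×ˢ Set.Ioi (0 : ℝ)) :=
    MeasurableSet.univ.prod measurableSet_Ioi
  have hpt : ∀ p ∈ (Set.univ : Set ℝ) ×ˢ Set.Ioi (0 : ℝ), |(shearFDeriv p).det| •
      g (measurableEquivRealProd.symm (shearMap p)) = (p.2 : ℂ) * g ⟨p.2 * p.1, p.2⟩ := by
    rintro ⟨x, y⟩ ⟨-, hy⟩
    have hy : 0 < y := hy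
    rw [det_shearFDeriv, abs_of_pos hy, real_smul]
    rfl
  rw [← hmp.setIntegral_preimage_emb measurableEquivRealProd.symm.measurableEmbedding, hpre]
  rw [← image_shearMap, integrableOn_image_iff_integrableOn_abs_det_fderiv_smul volume hms
    (fun p _ => (hasFDerivAt_shearMap p).hasFDerivWithinAt) injOn_shearMap,
    integrableOn_congr_fun hpt hms] at hg'
  rw [← image_shearMap, integral_image_eq_integral_abs_det_fderiv_smul volume hms
    (fun p _ => (hasFDerivAt_shearMap p).hasFDerivWithinAt) injOn_shearMap,
    setIntegral_congr_fun hms hpt, Measure.volume_eq_prod, setIntegral_prod _ hg',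
    setIntegral_univ]

theorem det_iwasawaMat (y x θ : ℝ) : (iwasawaMat y x θ).det = y := by
  rw [iwasawaMat, Matrix.det_mul, Matrix.det_fin_two_of, Matrix.det_fin_two_of]
  linear_combination y * Real.sin_sq_add_cos_sq θ

theorem inv_iwasawaMat {y : ℝ} (hy : y ≠ 0) (x θ : ℝ) : (iwasawaMat y x θ)⁻¹ =
    !![Real.cos θ, Real.sin θ; -Real.sin θ, Real.cos θ] * !![y⁻¹, -x; 0, 1] := by
  apply Matrix.inv_eq_left_inv
  have h := Real.sin_sq_add_cos_sq θ
  have hy' : y⁻¹ * y = 1 := inv_mul_cancel₀ hy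
  ext i j
  fin_cases i <;> fin_cases j <;>
    simp [iwasawaMat, Matrix.mul_apply, Fin.sum_univ_two]
  · linear_combination h + (Real.cos θ ^ 2 + Real.cos θ * x * Real.sin θ) * hy'
  · linear_combination (-Real.cos θ * Real.sin θ + Real.cos θ ^ 2 * x) * hy'
  · linear_combination (-Real.cos θ * Real.sin θ - Real.sin θ ^ 2 * x) * hy'
  · linear_combination h + (Real.sin θ ^ 2 - Real.cos θ * x * Real.sin θ) * hy'

theorem finf_denom_iwasawaMat (y x θ : ℝ) :
    -(iwasawaMat y x θ 0 1 : ℂ) + (iwasawaMat y x θ 1 0 : ℂ) +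
      ((iwasawaMat y x θ 0 0 : ℂ) + (iwasawaMat y x θ 1 1 : ℂ)) * I =
    (Real.cos θ - Real.sin θ * I) * (I - (starRingEnd ℂ) ⟨y * x, y⟩) := by
  apply Complex.ext <;>
    simp [iwasawaMat, Matrix.mul_apply, Fin.sum_univ_two, -ofReal_cos, -ofReal_sin] <;> ring

theorem finf_denom_inv_iwasawaMat_mul {y : ℝ} (hy : y ≠ 0) (x θ : ℝ)
    (g : Matrix (Fin 2) (Fin 2) ℝ) :
    -(((iwasawaMat y x θ)⁻¹ * g) 0 1 : ℂ) + (((iwasawaMat y x θ)⁻¹ * g) 1 0 : ℂ) +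
      ((((iwasawaMat y x θ)⁻¹ * g) 0 0 : ℂ) + (((iwasawaMat y x θ)⁻¹ * g) 1 1 : ℂ)) * I =
    (Real.cos θ + Real.sin θ * I) / y *
      ((g 1 1 - g 1 0 * I) * ⟨y * x, y⟩ + (g 0 0 * I - g 0 1)) := by
  rw [inv_iwasawaMat hy, div_mul_eq_mul_div, eq_div_iff (by exact_mod_cast hy)]
  apply Complex.ext <;>
    simp [Matrix.mul_apply, Fin.sum_univ_two, -ofReal_cos, -ofReal_sin] <;> field_simp <;> ring

theorem finf_mul_finf_div_of_pos (n : ℕ) {y : ℝ} (hy : 0 < y) (x θ : ℝ)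
    {g : Matrix (Fin 2) (Fin 2) ℝ} (hg : 0 < g.det) :
    finf (n + 2) (iwasawaMat y x θ) * finf (n + 2) ((iwasawaMat y x θ)⁻¹ * g) /
        ((|y| : ℝ) : ℂ) =
      (((n + 1) / (4 * Real.pi)) ^ 2 * ((g.det ^ (((n + 2 : ℕ) : ℝ) / 2) : ℝ) : ℂ) *
          ((2 * I) ^ (n + 2)) ^ 2) *
        (y * (((y ^ n : ℝ) : ℂ) *
          (((g 1 1 - g 1 0 * I) * ⟨y * x, y⟩ + (g 0 0 * I - g 0 1)) ^ (n + 2))⁻¹ *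
          ((I - (starRingEnd ℂ) ⟨y * x, y⟩) ^ (n + 2))⁻¹)) := by
  have hdet : ((iwasawaMat y x θ)⁻¹ * g).det = g.det / y := by
    rw [Matrix.det_mul, Matrix.det_nonsing_inv, det_iwasawaMat, Ring.inverse_eq_inv']
    ring
  have hrot : ((Real.cos θ : ℂ) - Real.sin θ * I) * (Real.cos θ + Real.sin θ * I) = 1 := by
    have h : ((Real.sin θ : ℂ)) ^ 2 + (Real.cos θ : ℂ) ^ 2 = 1 := by
      exact_mod_cast Real.sin_sq_add_cos_sq θ
    linear_combination h - (Real.sin θ : ℂ) ^ 2 * I_sq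
  have hyC : (y : ℂ) ≠ 0 := by exact_mod_cast hy.ne'
  have hpow : ((y ^ (((n + 2 : ℕ) : ℝ) / 2) : ℝ) : ℂ) *
      (((g.det / y) ^ (((n + 2 : ℕ) : ℝ) / 2) : ℝ) : ℂ) =
      ((g.det ^ (((n + 2 : ℕ) : ℝ) / 2) : ℝ) : ℂ) := by
    rw [← ofReal_mul, ← Real.mul_rpow hy.le (by positivity), mul_div_cancel₀ _ hy.ne']
  rw [finf, finf, if_pos (by rwa [det_iwasawaMat]), if_pos (by rw [hdet]; positivity), hdet,
    det_iwasawaMat, finf_denom_iwasawaMat, finf_denom_inv_iwasawaMat_mul hy.ne', abs_of_pos hy,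
    ← hpow]
  generalize (I - (starRingEnd ℂ) ⟨y * x, y⟩ : ℂ) = P
  generalize (g 1 1 - g 1 0 * I) * ⟨y * x, y⟩ + (g 0 0 * I - g 0 1 : ℂ) = Q
  have hden : ((Real.cos θ - Real.sin θ * I) * P) ^ (n + 2) *
      ((Real.cos θ + Real.sin θ * I) / y * Q) ^ (n + 2) =
      (P ^ (n + 2) * Q ^ (n + 2)) / (y : ℂ) ^ (n + 2) := by
    rw [← mul_pow, ← mul_pow, ← div_pow]
    congr 1
    rw [eq_div_iff hyC]
    field_simp
    linear_combination P * Q * hrot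
  rw [div_mul_div_comm, hden]
  push_cast
  simp only [div_eq_mul_inv, mul_inv, inv_inv]
  rw [pow_succ' _ (n + 1), pow_succ' _ n]
  field_simp
  ring

theorem finf_mul_finf_of_det_neg (k : ℕ) (y x θ : ℝ)
    {g : Matrix (Fin 2) (Fin 2) ℝ} (hg : g.det < 0) :
    finf k (iwasawaMat y x θ) * finf k ((iwasawaMat y x θ)⁻¹ * g) = 0 := by
  by_cases hy : 0 < y
  · have hdet : ((iwasawaMat y x θ)⁻¹ * g).det = g.det / y := by
      rw [Matrix.det_mul, Matrix.det_nonsing_inv, det_iwasawaMat, Ring.inverse_eq_inv']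
      ring
    rw [finf, finf, if_neg (c := 0 < ((iwasawaMat y x θ)⁻¹ * g).det), mul_zero]
    rw [hdet]
    exact (div_neg_of_neg_of_pos hg hy).le.not_gt
  · rw [finf, if_neg (by rwa [det_iwasawaMat]), zero_mul]

theorem norm_lt_norm_of_det_pos {g : Matrix (Fin 2) (Fin 2) ℝ} (hg : 0 < g.det) :
    ‖I * (g 1 1 - g 1 0 * I) - (g 0 0 * I - g 0 1)‖ <
      ‖I * (g 1 1 - g 1 0 * I) + (g 0 0 * I - g 0 1)‖ := by
  refine lt_of_pow_lt_pow_left₀ 2 (norm_nonneg _) ?_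
  rw [← normSq_eq_norm_sq, ← normSq_eq_norm_sq]
  rw [Matrix.det_fin_two] at hg
  simp [normSq_apply]
  nlinarith

open MeasureTheory in
theorem integral_finf_mul_finf_of_pos (n : ℕ) (θ : ℝ)
    {g : Matrix (Fin 2) (Fin 2) ℝ} (hg : 0 < g.det) :
    ∫ x : ℝ, ∫ y : ℝ, finf (n + 2) (iwasawaMat y x θ) *
      finf (n + 2) ((iwasawaMat y x θ)⁻¹ * g) / ((|y| : ℝ) : ℂ) = finf (n + 2) g := by
  have hab := norm_lt_norm_of_det_pos hg
  have hinner : ∀ x : ℝ, ∫ y : ℝ, finf (n + 2) (iwasawaMat y x θ) *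
      finf (n + 2) ((iwasawaMat y x θ)⁻¹ * g) / ((|y| : ℝ) : ℂ) =
      (((n + 1) / (4 * Real.pi)) ^ 2 * ((g.det ^ (((n + 2 : ℕ) : ℝ) / 2) : ℝ) : ℂ) *
          ((2 * I) ^ (n + 2)) ^ 2) * ∫ y in Set.Ioi (0 : ℝ),
        (y * (((y ^ n : ℝ) : ℂ) *
          (((g 1 1 - g 1 0 * I) * ⟨y * x, y⟩ + (g 0 0 * I - g 0 1)) ^ (n + 2))⁻¹ *
          ((I - (starRingEnd ℂ) ⟨y * x, y⟩) ^ (n + 2))⁻¹)) := by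
    intro x
    rw [← integral_const_mul, ← setIntegral_congr_fun measurableSet_Ioi
      (fun y hy => finf_mul_finf_div_of_pos n hy x θ hg)]
    symm
    apply setIntegral_eq_integral_of_forall_compl_eq_zero
    intro y hy
    rw [finf, if_neg (by rwa [det_iwasawaMat]), zero_mul, zero_div]
  simp_rw [hinner]
  rw [integral_const_mul,
    integral_integral_shear (integrableOn_upperHalfPlane_reproducing hab n),
    integral_upperHalfPlane_reproducing hab n, finf, if_pos hg]
  have hden : I * (g 1 1 - g 1 0 * I) + (g 0 0 * I - g 0 1) =
      -(g 0 1 : ℂ) + (g 1 0 : ℂ) + ((g 0 0 : ℂ) + (g 1 1 : ℂ)) * I := by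
    linear_combination -(g 1 0 : ℂ) * I_sq
  rw [hden]
  have hpi : (Real.pi : ℂ) ≠ 0 := by exact_mod_cast Real.pi_ne_zero
  have hn : (n : ℂ) + 1 ≠ 0 := by exact_mod_cast n.succ_ne_zero
  have h2 : ((2 : ℂ) * I) ^ (n + 2) ≠ 0 := pow_ne_zero _ (by simp)
  generalize ((2 : ℂ) * I) ^ (n + 2) = T at h2 ⊢
  rw [div_eq_mul_inv _ ((_ : ℂ) ^ (n + 2))]
  push_cast
  field_simp
  ring

/-- **Idempotence of `f_∞` under convolution (Section 5 of the paper).**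
For `k > 2`, `f_∞ * f_∞ = f_∞` as functions on `GL₂(ℝ)` modulo its center, with Haar
measure `(dy/|y|) dx (dθ/2π)` in the Iwasawa coordinates `h_{y,x,θ}`. -/
theorem finf_convolution_idempotent
    (k : ℕ) (hk : 2 < k) (g₀ : Matrix (Fin 2) (Fin 2) ℝ) (hg₀ : g₀.det ≠ 0) :
    (1 / (2 * (Real.pi : ℂ))) *
      ∫ θ in (0 : ℝ)..(2 * Real.pi), ∫ x : ℝ, ∫ y : ℝ,
        finf k (iwasawaMat y x θ) * finf k ((iwasawaMat y x θ)⁻¹ * g₀) / ((|y| : ℝ) : ℂ)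
      = finf k g₀ := by
  rcases lt_or_gt_of_ne hg₀ with hg | hg
  · simp_rw [finf_mul_finf_of_det_neg k _ _ _ hg]
    simp [finf, hg.le.not_gt]
  · obtain ⟨n, rfl⟩ : ∃ n, k = n + 2 := ⟨k - 2, by omega⟩
    simp_rw [integral_finf_mul_finf_of_pos n _ hg]
    rw [intervalIntegral.integral_const, sub_zero, real_smul]
    have hpi : (Real.pi : ℂ) ≠ 0 := by exact_mod_cast Real.pi_ne_zero
    push_cast
    field_simp

end
end

section
/- Let p be a prime, let D and n be positive integers with p | D and p ∤ n, let b be a nonzero integer and d a positive integer, let u, m ∈ ℤ_p^× be p-adic units, and let x ∈ ℤ_p. Suppose that (i) ub/(dD) + dm/D ∈ ℤ_p and (ii) (x/d)·(ub/(dD) + dm/D) − nu/d ∈ ℤ_p, as elements of ℚ_p. Then, writing v_p for the p-adic valuation: if v_p(d) > v_p(D) then v_p(b) = v_p(d) + v_p(D); if v_p(d) = v_p(D) then v_p(b) ≥ 2 v_p(D); and if v_p(d) < v_p(D) then v_p(b) = 2 v_p(d). Moreover, if p | d then in addition x ∈ ℤ_p^× and ub/(dD) + dm/D ∈ ℤ_p^×.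 -/
noncomputable section

theorem Padic.norm_natCast_eq_zpow_neg_padicValNat {p : ℕ} [Fact p.Prime] {k : ℕ} (hk : k ≠ 0) :
    ‖(k : ℚ_[p])‖ = (p : ℝ) ^ (-(padicValNat p k : ℤ)) := by
  rw [Padic.norm_eq_zpow_neg_valuation (Nat.cast_ne_zero.mpr hk), Padic.valuation_natCast]

theorem Padic.norm_intCast_eq_zpow_neg_padicValInt {p : ℕ} [Fact p.Prime] {k : ℤ} (hk : k ≠ 0) :
    ‖(k : ℚ_[p])‖ = (p : ℝ) ^ (-(padicValInt p k : ℤ)) := by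
  rw [Padic.norm_eq_zpow_neg_valuation (Int.cast_ne_zero.mpr hk), Padic.valuation_intCast]

/-- If `(x y - w) / d` is `p`-adically integral with `‖d‖ < 1`, `‖w‖ = 1` and `x`, `y` integral,
then `x` and `y` are units. -/
theorem Padic.norm_eq_one_of_norm_div_mul_sub_div_le_one {p : ℕ} [Fact p.Prime]
    {x y w d : ℚ_[p]} (hd0 : d ≠ 0) (hd : ‖d‖ < 1) (hw : ‖w‖ = 1) (hx : ‖x‖ ≤ 1) (hy : ‖y‖ ≤ 1)
    (h : ‖x / d * y - w / d‖ ≤ 1) : ‖x‖ = 1 ∧ ‖y‖ = 1 := by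
  have hdiff : ‖x * y - w‖ < 1 := by
    have e : x * y - w = d * (x / d * y - w / d) := by field_simp
    rw [e, norm_mul]
    exact (mul_le_of_le_one_right (norm_nonneg _) h).trans_lt hd
  have hxy : ‖x‖ * ‖y‖ = 1 := by
    rw [← norm_mul, ← hw]
    by_contra hne
    have hmax := Padic.add_eq_max_of_ne (q := x * y) (r := -w) (by rwa [norm_neg])
    rw [← sub_eq_add_neg, norm_neg, hw] at hmax
    exact absurd (hmax ▸ le_max_right ‖x * y‖ 1) hdiff.not_ge
  constructor <;> nlinarith [norm_nonneg x, norm_nonneg y]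

/-- **Local support conditions at `p ∣ D` (equation (7.5) of the paper).**
Let `p ∣ D`, `p ∤ n`, `b ≠ 0`, `d > 0`, let `u, m ∈ ℤ_p^×` and `x ∈ ℤ_p`, and suppose
(i) `ub/(dD) + dm/D ∈ ℤ_p` and (ii) `(x/d)(ub/(dD) + dm/D) - nu/d ∈ ℤ_p` in `ℚ_p`. Then:
if `v_p(d) > v_p(D)` then `v_p(b) = v_p(d) + v_p(D)`; if `v_p(d) = v_p(D)` then
`v_p(b) ≥ 2 v_p(D)`; if `v_p(d) < v_p(D)` then `v_p(b) = 2 v_p(d)`; and if moreover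
`p ∣ d` then `x ∈ ℤ_p^×` and `ub/(dD) + dm/D ∈ ℤ_p^×`. -/
theorem local_support_conditions
    (p : ℕ) [Fact p.Prime] (D n : ℕ) (hD : 0 < D) (hn : 0 < n)
    (hpD : p ∣ D) (hpn : ¬ p ∣ n)
    (b : ℤ) (hb : b ≠ 0) (d : ℕ) (hd : 0 < d)
    (u m x : ℤ_[p]) (hu : IsUnit u) (hm : IsUnit m)
    (hi : ‖(u : ℚ_[p]) * (b : ℚ_[p]) / ((d : ℚ_[p]) * (D : ℚ_[p])) +
        (d : ℚ_[p]) * (m : ℚ_[p]) / (D : ℚ_[p])‖ ≤ 1)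
    (hii : ‖((x : ℚ_[p]) / (d : ℚ_[p])) *
          ((u : ℚ_[p]) * (b : ℚ_[p]) / ((d : ℚ_[p]) * (D : ℚ_[p])) +
            (d : ℚ_[p]) * (m : ℚ_[p]) / (D : ℚ_[p])) -
        (n : ℚ_[p]) * (u : ℚ_[p]) / (d : ℚ_[p])‖ ≤ 1) :
    (padicValNat p D < padicValNat p d →
      padicValInt p b = padicValNat p d + padicValNat p D) ∧
    (padicValNat p d = padicValNat p D →
      2 * padicValNat p D ≤ padicValInt p b) ∧
    (padicValNat p d < padicValNat p D →
      padicValInt p b = 2 * padicValNat p d) ∧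
    (p ∣ d →
      IsUnit x ∧
      ‖(u : ℚ_[p]) * (b : ℚ_[p]) / ((d : ℚ_[p]) * (D : ℚ_[p])) +
          (d : ℚ_[p]) * (m : ℚ_[p]) / (D : ℚ_[p])‖ = 1) := by
  have hp1 : (1 : ℝ) < p := by exact_mod_cast (Fact.out : p.Prime).one_lt
  have hp0 : (p : ℝ) ≠ 0 := by positivity
  have hu1 : ‖(u : ℚ_[p])‖ = 1 := PadicInt.isUnit_iff.mp hu
  have hm1 : ‖(m : ℚ_[p])‖ = 1 := PadicInt.isUnit_iff.mp hm
  have hn1 : ‖(n : ℚ_[p])‖ = 1 :=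
    Padic.norm_natCast_eq_one_iff.mpr
      (((Fact.out : p.Prime).coprime_iff_not_dvd).mpr hpn)
  have hunits (hpd : p ∣ d) := Padic.norm_eq_one_of_norm_div_mul_sub_div_le_one
    (Nat.cast_ne_zero.mpr hd.ne') ((Padic.norm_natCast_lt_one_iff).mpr hpd)
    (by rw [norm_mul, hn1, hu1, one_mul]) x.norm_le_one hi hii
  have hA : ‖(u : ℚ_[p]) * (b : ℚ_[p]) / ((d : ℚ_[p]) * (D : ℚ_[p]))‖ =
      (p : ℝ) ^ ((padicValNat p d + padicValNat p D : ℤ) - padicValInt p b) := by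
    rw [norm_div, norm_mul, norm_mul, hu1, Padic.norm_intCast_eq_zpow_neg_padicValInt hb,
      Padic.norm_natCast_eq_zpow_neg_padicValNat hd.ne',
      Padic.norm_natCast_eq_zpow_neg_padicValNat hD.ne', one_mul, ← zpow_add₀ hp0,
      ← zpow_sub₀ hp0]
    congr 1
    ring
  have hB : ‖(d : ℚ_[p]) * (m : ℚ_[p]) / (D : ℚ_[p])‖ =
      (p : ℝ) ^ ((padicValNat p D : ℤ) - padicValNat p d) := by
    rw [norm_div, norm_mul, hm1, Padic.norm_natCast_eq_zpow_neg_padicValNat hd.ne',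
      Padic.norm_natCast_eq_zpow_neg_padicValNat hD.ne', mul_one, ← zpow_sub₀ hp0]
    congr 1
    ring
  set A := (u : ℚ_[p]) * (b : ℚ_[p]) / ((d : ℚ_[p]) * (D : ℚ_[p]))
  set B := (d : ℚ_[p]) * (m : ℚ_[p]) / (D : ℚ_[p])
  refine ⟨fun h => ?_, fun h => ?_, fun h => ?_,
    fun hpd => ⟨PadicInt.isUnit_iff.mpr (hunits hpd).1, (hunits hpd).2⟩⟩
  · have hy := (hunits (dvd_of_one_le_padicValNat (by omega))).2
    have hB1 : ‖B‖ < 1 := hB ▸ zpow_lt_one_of_neg₀ hp1 (by omega)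
    have hA1 : ‖A‖ = 1 := by
      by_cases hAB : ‖A‖ = ‖B‖
      · have := Padic.nonarchimedean A B
        rw [hAB, max_self, hy] at this
        linarith
      · rw [Padic.add_eq_max_of_ne hAB] at hy
        rcases max_choice ‖A‖ ‖B‖ with h | h <;> rw [h] at hy <;> linarith
    rw [hA, zpow_eq_one_iff_right₀ (by positivity) hp1.ne'] at hA1
    omega
  · have hB1 : ‖B‖ = 1 := by rw [hB, h, sub_self, zpow_zero]
    have hA1 : ‖A‖ ≤ 1 := by
      by_contra! hlt
      rw [Padic.add_eq_max_of_ne (by linarith)] at hi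
      exact (((le_max_left _ _).trans hi).trans_lt hlt).false
    rw [hA, zpow_le_one_iff_right₀ hp1] at hA1
    omega
  · have hB1 : 1 < ‖B‖ := hB ▸ one_lt_zpow₀ hp1 (by omega)
    have hAB : ‖A‖ = ‖B‖ := by
      by_contra hne
      rw [Padic.add_eq_max_of_ne hne] at hi
      exact (((le_max_right _ _).trans hi).trans_lt hB1).false
    rw [hA, hB] at hAB
    have := zpow_right_injective₀ (by positivity) hp1.ne' hAB
    omega

end
end
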